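/- There exists a finite colouring ν of the positive reals ℝ⁺, each of whose colour classes is either countable or open in ℝ⁺ (in particular, each colour class is Lebesgue measurable), such that there is no injective sequence (x_n)_{n≥1} of positive reals which is bounded above and bounded away from zero and for which all the numbers x_n + x_m and x_n · x_m, for all pairs 1 ≤ n < m, have the same colour under ν. -/

import Mathlib

open Filter Topology

noncomputable def WW (y : ℝ) : ℝ := Real.logb 2 ((Real.log (y / 4)) ^ 2)

open Classical in
noncomputable def nuu (y : ℝ) : Fin 5 :=
  if ∃ k : ℤ, WW y = k then 4 else ⟨(⌊WW y⌋ % 4).toNat, by omega⟩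

lemma nuu_four {y : ℝ} (h : nuu y = 4) : ∃ k : ℤ, WW y = k := by
  by_contra hc
  rw [nuu, if_neg hc] at h
  have := congrArg Fin.val h
  simp at this
  omega

lemma nuu_ne {y : ℝ} (h : nuu y ≠ 4) : ¬ (∃ k : ℤ, WW y = k) ∧
    ((nuu y).val : ℤ) = ⌊WW y⌋ % 4 := by
  have hc : ¬ (∃ k : ℤ, WW y = k) := by
    intro hc
    exact h (by rw [nuu, if_pos hc])
  refine ⟨hc, ?_⟩
  rw [nuu, if_neg hc]
  simp
  omega

lemma WW_cont {y : ℝ} (hy : 0 < y) (hc : ¬ (∃ k : ℤ, WW y = k)) : ContinuousAt WW y := by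
  have h0 : Real.log (y / 4) ≠ 0 := by
    intro h
    exact hc ⟨0, by simp [WW, h]⟩
  have h1 : ContinuousAt (fun y : ℝ => (Real.log (y / 4)) ^ 2) y :=
    ((continuousAt_id.div_const 4).log (by simp; positivity)).pow 2
  unfold WW Real.logb
  exact (h1.log (by positivity)).div_const _

lemma WW_pow {y : ℝ} (h0 : Real.log (y / 4) ≠ 0) :
    (Real.log (y / 4)) ^ 2 = (2 : ℝ) ^ (WW y) := by
  rw [WW, Real.rpow_logb (by norm_num) (by norm_num) (by positivity)]

lemma nuu_countable : {y : ℝ | 0 < y ∧ nuu y = 4}.Countable := by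
  have : {y : ℝ | 0 < y ∧ nuu y = 4} ⊆ {4} ∪ ⋃ k : ℤ,
      ({4 * Real.exp (√((2 : ℝ) ^ (k : ℝ))), 4 * Real.exp (-√((2 : ℝ) ^ (k : ℝ)))} : Set ℝ) := by
    rintro y ⟨hy, h⟩
    obtain ⟨k, hk⟩ := nuu_four h
    have hyy : y = 4 * Real.exp (Real.log (y / 4)) := by
      rw [Real.exp_log (by positivity)]; ring
    by_cases h0 : Real.log (y / 4) = 0
    · left
      rw [h0] at hyy
      simpa using hyy
    · right
      have h2 := WW_pow h0
      rw [hk] at h2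
      have h3 : |Real.log (y / 4)| = √((2 : ℝ) ^ (k : ℝ)) := by
        rw [← h2, Real.sqrt_sq_eq_abs]
      simp only [Set.mem_iUnion]
      refine ⟨k, ?_⟩
      rw [← h3]
      rcases abs_choice (Real.log (y / 4)) with h4 | h4
      · left; rw [h4]; exact hyy
      · right; rw [h4, neg_neg]; exact hyy
  refine Set.Countable.mono this ?_
  refine (Set.countable_singleton _).union (Set.countable_iUnion fun k => ?_)
  exact (Set.toFinite _).countable

lemma nuu_open {i : Fin 5} (hi : i ≠ 4) : IsOpen {y : ℝ | 0 < y ∧ nuu y = i} := by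
  rw [isOpen_iff_mem_nhds]
  rintro y ⟨hy, rfl⟩
  obtain ⟨hc, hv⟩ := nuu_ne hi
  have h1 : (⌊WW y⌋ : ℝ) < WW y :=
    lt_of_le_of_ne (Int.floor_le _) fun h => hc ⟨_, h.symm⟩
  have h2 := Int.lt_floor_add_one (WW y)
  have hcont := WW_cont hy hc
  filter_upwards [lt_mem_nhds hy, hcont.eventually (lt_mem_nhds h1),
    hcont.eventually (gt_mem_nhds h2)] with z hz hz1 hz2
  refine ⟨hz, ?_⟩
  have hfl : ⌊WW z⌋ = ⌊WW y⌋ := by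
    rw [Int.floor_eq_iff]; exact ⟨hz1.le, hz2⟩
  have hcz : ¬ ∃ k : ℤ, WW z = k := by
    rintro ⟨k, hk⟩
    rw [hk] at hz1 hz2
    have a : ⌊WW y⌋ < k := by exact_mod_cast hz1
    have b : k < ⌊WW y⌋ + 1 := by exact_mod_cast hz2
    omega
  rw [nuu, if_neg hcz]
  apply Fin.ext
  simp only [hfl]
  omega

/-- products and sums in the good range have different colours -/
lemma nuu_diff {s p : ℝ} (h1 : 2 * (Real.log (s / 4)) ^ 2 < (Real.log (p / 4)) ^ 2)
    (h2 : (Real.log (p / 4)) ^ 2 < 8 * (Real.log (s / 4)) ^ 2)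
    (hs : nuu s ≠ 4) (h : nuu s = nuu p) : False := by
  have hs' := (nuu_ne hs).2
  have hp' := (nuu_ne (h ▸ hs)).2
  rw [h, hp'] at hs'
  have s0 : 0 < (Real.log (s / 4)) ^ 2 := by
    by_contra hh; nlinarith [sq_nonneg (Real.log (s / 4)), sq_nonneg (Real.log (p / 4))]
  have a1 : WW s + 1 < WW p := by
    have := Real.logb_lt_logb (b := 2) (by norm_num) (by positivity) h1
    rw [Real.logb_mul (by norm_num) s0.ne', Real.logb_self_eq_one (by norm_num)] at this
    unfold WW; linarith
  have a2 : WW p < WW s + 3 := by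
    have := Real.logb_lt_logb (b := 2) (by norm_num) (by linarith) h2
    rw [Real.logb_mul (by norm_num) s0.ne', show (8:ℝ) = (2:ℝ) ^ (3:ℝ) by norm_num,
      Real.logb_rpow (by norm_num) (by norm_num)] at this
    unfold WW; linarith
  have b1 : ⌊WW s⌋ < ⌊WW p⌋ := by
    have := Int.floor_mono a1.le
    rw [Int.floor_add_one] at this; omega
  have b2 : ⌊WW p⌋ < ⌊WW s⌋ + 4 := by
    have := Int.floor_mono a2.le
    rw [show (3:ℝ) = ((3:ℤ):ℝ) by norm_num, Int.floor_add_intCast] at this; omega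
  omega

lemma key_two {t : ℝ} (ht0 : t ≠ 0) (h1 : -(1/8) < t) (h2 : t < 1/8) :
    2 * (Real.log (1 + t)) ^ 2 < (Real.log (1 + 2 * t)) ^ 2 ∧
    (Real.log (1 + 2 * t)) ^ 2 < 8 * (Real.log (1 + t)) ^ 2 := by
  have up : Real.log (1 + 2 * t) ≤ 2 * Real.log (1 + t) := by
    have := Real.log_le_log (x := 1 + 2 * t) (y := (1 + t) ^ 2) (by linarith)
      (by nlinarith [sq_nonneg t])
    rw [Real.log_pow] at this; exact_mod_cast this
  rcases lt_or_gt_of_ne ht0 with h | h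
  · have n1 : Real.log (1 + t) < 0 := Real.log_neg (by linarith) (by linarith)
    have lo : 5 * Real.log (1 + t) ≤ 2 * Real.log (1 + 2 * t) := by
      have := Real.log_le_log (x := (1 + t) ^ 5) (y := (1 + 2 * t) ^ 2)
        (by have : 0 < 1 + t := by linarith
            positivity)
        (by
          obtain ⟨s, rfl⟩ : ∃ s, t = -s := ⟨-t, by ring⟩
          have hs : 0 < s := by linarith
          have : 0 ≤ s * (1 - 6 * s + 10 * s ^ 2 - 5 * s ^ 3 + s ^ 4) := by
            apply mul_nonneg hs.le
            have : 0 ≤ s ^ 2 * (10 - 5 * s) := mul_nonneg (sq_nonneg _) (by linarith)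
            nlinarith [sq_nonneg (s ^ 2)]
          nlinarith [this])
      rw [Real.log_pow, Real.log_pow] at this; exact_mod_cast this
    constructor <;> nlinarith
  · have n1 : 0 < Real.log (1 + t) := Real.log_pos (by linarith)
    have lo : 3 * Real.log (1 + t) ≤ 2 * Real.log (1 + 2 * t) := by
      have := Real.log_le_log (x := (1 + t) ^ 3) (y := (1 + 2 * t) ^ 2) (by positivity)
        (by
          have : 0 ≤ t * (1 + t - t ^ 2) := mul_nonneg h.le (by nlinarith)
          nlinarith [this])
      rw [Real.log_pow, Real.log_pow] at this; exact_mod_cast this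
    constructor <;> nlinarith

lemma key_ev {L : ℝ} (hL : 0 < L) : ∀ᶠ x in 𝓝[≠] L,
    2 * (Real.log ((x + L) / 4)) ^ 2 < (Real.log (x * L / 4)) ^ 2 ∧
    (Real.log (x * L / 4)) ^ 2 < 8 * (Real.log ((x + L) / 4)) ^ 2 := by
  by_cases h2 : L = 2
  · subst h2
    have e1 : ∀ᶠ x : ℝ in 𝓝[≠] 2, 3/2 < x := nhdsWithin_le_nhds (lt_mem_nhds (by norm_num))
    have e2 : ∀ᶠ x : ℝ in 𝓝[≠] 2, x < 5/2 := nhdsWithin_le_nhds (gt_mem_nhds (by norm_num))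
    filter_upwards [e1, e2, self_mem_nhdsWithin] with x h1 h2 h3
    have := key_two (t := (x - 2) / 4) (by
      intro h; apply h3; simp; linarith) (by linarith) (by linarith)
    rw [show 1 + (x - 2) / 4 = (x + 2) / 4 by ring,
      show 1 + 2 * ((x - 2) / 4) = x * 2 / 4 by ring] at this
    exact this
  · apply nhdsWithin_le_nhds
    have c1 : ContinuousAt (fun x : ℝ => (Real.log ((x + L) / 4)) ^ 2) L :=
      (((continuousAt_id.add continuousAt_const).div_const 4).log (by simp; positivity)).pow 2
    have c2 : ContinuousAt (fun x : ℝ => (Real.log (x * L / 4)) ^ 2) L :=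
      (((continuousAt_id.mul continuousAt_const).div_const 4).log (by simp; positivity)).pow 2
    have hS : Real.log ((L + L) / 4) ≠ 0 := by
      apply Real.log_ne_zero_of_pos_of_ne_one (by positivity)
      intro h; apply h2; linarith
    have hP : Real.log (L * L / 4) = 2 * Real.log ((L + L) / 4) := by
      rw [show L * L / 4 = ((L + L) / 4) ^ 2 by ring, Real.log_pow]; norm_num
    have hS2 : 0 < (Real.log ((L + L) / 4)) ^ 2 := by positivity
    refine ((continuousAt_const.mul c1).eventually_lt c2 ?_).and
      (c2.eventually_lt (continuousAt_const.mul c1) ?_)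
    · change 2 * (Real.log ((L + L) / 4)) ^ 2 < (Real.log (L * L / 4)) ^ 2
      rw [hP]; nlinarith
    · change (Real.log (L * L / 4)) ^ 2 < 8 * (Real.log ((L + L) / 4)) ^ 2
      rw [hP]; nlinarith

lemma main_aux (x : ℕ → ℝ) (col : Fin 5) (L : ℝ) (hL : 0 < L) (hpos : ∀ n, 0 < x n)
    (hinj : Function.Injective x) (hlim : Tendsto x atTop (𝓝 L))
    (h : ∀ n m, n < m → nuu (x n + x m) = col ∧ nuu (x n * x m) = col) : False := by
  have hlim' : Tendsto x atTop (𝓝[≠] L) := by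
    refine tendsto_nhdsWithin_iff.2 ⟨hlim, ?_⟩
    rw [← Nat.cofinite_eq_atTop]
    exact hinj.tendsto_cofinite.eventually (eventually_cofinite_ne L)
  obtain ⟨n, hn1, hn2⟩ := (hlim'.eventually (key_ev hL)).exists
  have hxn := hpos n
  have tS : Tendsto (fun m => (Real.log ((x n + x m) / 4)) ^ 2) atTop
      (𝓝 ((Real.log ((x n + L) / 4)) ^ 2)) :=
    (((tendsto_const_nhds.add hlim).div_const 4).log (by positivity)).pow 2
  have tP : Tendsto (fun m => (Real.log ((x n * x m) / 4)) ^ 2) atTop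
      (𝓝 ((Real.log ((x n * L) / 4)) ^ 2)) :=
    (((tendsto_const_nhds.mul hlim).div_const 4).log (by positivity)).pow 2
  have s0 : 0 < (Real.log ((x n + L) / 4)) ^ 2 := by
    have := sq_nonneg (Real.log ((x n + L) / 4))
    have := sq_nonneg (Real.log ((x n * L) / 4))
    linarith
  by_cases hcol : col = 4
  · have tW : Tendsto (fun m => WW (x n + x m)) atTop
        (𝓝 (Real.logb 2 ((Real.log ((x n + L) / 4)) ^ 2))) := by
      unfold WW Real.logb
      exact (tS.log s0.ne').div_const _
    set w := Real.logb 2 ((Real.log ((x n + L) / 4)) ^ 2)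
    have e1 := tW.eventually (lt_mem_nhds (show w - 1/2 < w by linarith))
    have e2 := tW.eventually (gt_mem_nhds (show w < w + 1/2 by linarith))
    have e3 := tS.eventually (lt_mem_nhds s0)
    obtain ⟨M, hM⟩ := eventually_atTop.1 ((e1.and e2).and (e3.and (eventually_gt_atTop n)))
    have key : ∀ m, M ≤ m → (Real.log ((x n + x m) / 4)) ^ 2
        = (Real.log ((x n + x M) / 4)) ^ 2 := by
      intro m hm
      obtain ⟨⟨a1, a2⟩, a3, a4⟩ := hM m hm
      obtain ⟨⟨b1, b2⟩, b3, b4⟩ := hM M le_rfl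
      obtain ⟨k, hk⟩ := nuu_four ((h n m a4).1.trans hcol)
      obtain ⟨l, hl⟩ := nuu_four ((h n M b4).1.trans hcol)
      have hkl : k = l := by
        rw [hk] at a1 a2
        rw [hl] at b1 b2
        have c1 : (k : ℝ) < l + 1 := by linarith
        have c2 : (l : ℝ) < k + 1 := by linarith
        have c1' : k < l + 1 := by exact_mod_cast c1
        have c2' : l < k + 1 := by exact_mod_cast c2
        omega
      rw [WW_pow (by intro h; rw [h] at a3; simp at a3),
        WW_pow (by intro h; rw [h] at b3; simp at b3), hk, hl, hkl]
    have inj : ∀ a b, Real.log ((x n + x a) / 4) = Real.log ((x n + x b) / 4) → a = b := by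
      intro a b hab
      have ha := hpos a
      have hb := hpos b
      have := Real.log_injOn_pos (Set.mem_Ioi.2 (by positivity)) (Set.mem_Ioi.2 (by positivity)) hab
      exact hinj (by linarith)
    rcases sq_eq_sq_iff_eq_or_eq_neg.1 (key (M + 1) (by omega)) with k1 | k1
    · have := inj _ _ k1; omega
    rcases sq_eq_sq_iff_eq_or_eq_neg.1 (key (M + 2) (by omega)) with k2 | k2
    · have := inj _ _ k2; omega
    have := inj _ _ (k1.trans k2.symm)
    omega
  · obtain ⟨m, ⟨h1, h2⟩, hm⟩ := (((tS.const_mul 2).eventually_lt tP hn1).and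
      (tP.eventually_lt (tS.const_mul 8) hn2) |>.and (eventually_gt_atTop n)).exists
    obtain ⟨hs, hp⟩ := h n m hm
    exact nuu_diff h1 h2 (hs ▸ hcol) (hs.trans hp.symm)


/-- There exists a finite colouring `ν` of the positive reals, each colour class of which
is either countable or open in `ℝ⁺`, such that there is no injective sequence `(x_n)` of
positive reals, bounded above and bounded away from zero, with all the numbers
`x_n + x_m` and `x_n * x_m` (for `n < m`) of the same colour. -/
theorem stmt_6 :
    ∃ (r : ℕ) (ν : ℝ → Fin r),
      (∀ i : Fin r,
        ({x : ℝ | 0 < x ∧ ν x = i}).Countable ∨ IsOpen {x : ℝ | 0 < x ∧ ν x = i}) ∧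
      ¬ ∃ (x : ℕ → ℝ) (col : Fin r),
        Function.Injective x ∧
        (∃ c C : ℝ, 0 < c ∧ ∀ n, c ≤ x n ∧ x n ≤ C) ∧
        (∀ n m, n < m → ν (x n + x m) = col ∧ ν (x n * x m) = col) := by
  refine ⟨5, nuu, ?_, ?_⟩
  · intro i
    by_cases hi : i = 4
    · left; subst hi; exact nuu_countable
    · right; exact nuu_open hi
  · rintro ⟨x, col, hinj, ⟨c, C, hc, hb⟩, h⟩
    obtain ⟨L, hL, φ, hφ, hlim⟩ := isCompact_Icc.tendsto_subseq (x := x) (s := Set.Icc c C)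
      (fun n => hb n)
    exact main_aux (x ∘ φ) col L (lt_of_lt_of_le hc hL.1)
      (fun n => lt_of_lt_of_le hc (hb _).1) (hinj.comp hφ.injective) hlim
      (fun n m hnm => h _ _ (hφ hnm))
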